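/- For all k = 1,…,d−1 and all α = 1,…,m−2, the ideal observables satisfy the linear relation conj(μ_{α,k}) (O_{1,2})^k + conj(ν_{α,k}) (O_{1,α+2})^k + τ_{α,k} (O_{1,α+3})^k = 0 (the d×d zero matrix). -/

import Mathlib

open Matrix

/-- `omg d t` is ω^t = exp(2πi·t/d), where ω = exp(2πi/d). -/
noncomputable def omg (d : ℕ) (t : ℝ) : ℂ :=
  Complex.exp ((2 * Real.pi * t / d : ℝ) * Complex.I)

/-- γ_m(x) = (2x−1)/(2m). -/
noncomputable def gam (m x : ℕ) : ℝ := (2 * (x : ℝ) - 1) / (2 * m)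

/-- O_{1,x} = Σ_{i=0}^{d−2} ω^{γ_m(x)} |i⟩⟨i+1| + ω^{(1−d)γ_m(x)} |d−1⟩⟨0|. -/
noncomputable def Oone (d m x : ℕ) : Matrix (Fin d) (Fin d) ℂ :=
  Matrix.of fun i j =>
    (if (j : ℕ) = (i : ℕ) + 1 then omg d (gam m x) else 0) +
      (if (i : ℕ) = d - 1 ∧ (j : ℕ) = 0 then omg d ((1 - (d : ℝ)) * gam m x) else 0)

/-- The coefficient μ_{α,k}. -/
noncomputable def muc (d m α k : ℕ) : ℂ :=
  if α = m - 2 then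
    -(omg d (-(k : ℝ)) * omg d (-(((d : ℝ) - 2 * k) / (2 * m)))) /
      ((2 * Real.cos (Real.pi / (2 * m)) * Real.sqrt (2 * Real.cos (Real.pi / m)) : ℝ) : ℂ)
  else
    omg d (((α : ℝ) + 1) * ((d : ℝ) - 2 * k) / (2 * m)) /
        ((2 * Real.cos (Real.pi / (2 * m)) : ℝ) : ℂ) *
      ((Real.sin (Real.pi / m) /
          Real.sqrt (Real.sin (Real.pi * α / m) * Real.sin (Real.pi * (α + 1) / m)) : ℝ) : ℂ)

/-- The coefficient ν_{α,k}. -/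
noncomputable def nuc (d m α k : ℕ) : ℂ :=
  if α = m - 2 then
    -(omg d (((d : ℝ) - 2 * k) / (2 * m))) /
      ((2 * Real.cos (Real.pi / (2 * m)) * Real.sqrt (2 * Real.cos (Real.pi / m)) : ℝ) : ℂ)
  else
    -(omg d (((d : ℝ) - 2 * k) / (2 * m))) / ((2 * Real.cos (Real.pi / (2 * m)) : ℝ) : ℂ) *
      ((Real.sqrt (Real.sin (Real.pi * (α + 1) / m) / Real.sin (Real.pi * α / m)) : ℝ) : ℂ)

/-- The coefficient τ_{α,k}. -/
noncomputable def tauc (m α k : ℕ) : ℂ :=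
  if α = m - 2 then
    ((Real.sqrt (2 * Real.cos (Real.pi / m)) / (2 * Real.cos (Real.pi / (2 * m))) : ℝ) : ℂ)
  else
    ((1 / (2 * Real.cos (Real.pi / (2 * m))) *
      Real.sqrt (Real.sin (Real.pi * α / m) / Real.sin (Real.pi * (α + 1) / m)) : ℝ) : ℂ)

theorem omg_add (d : ℕ) (s t : ℝ) : omg d (s + t) = omg d s * omg d t := by
  rw [omg, omg, omg, ← Complex.exp_add]
  congr 1
  push_cast
  ring

theorem star_omg (d : ℕ) (t : ℝ) : (starRingEnd ℂ) (omg d t) = omg d (-t) := by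
  rw [omg, omg, ← Complex.exp_conj]
  congr 1
  simp only [map_mul, Complex.conj_ofReal, Complex.conj_I]
  push_cast
  ring

theorem omg_mul_self {d : ℕ} (hd : d ≠ 0) (t : ℝ) :
    omg d (d * t) = Complex.exp ((2 * Real.pi * t : ℝ) * Complex.I) := by
  rw [omg]
  congr 3
  field_simp

/-- Entries of the powers of `Oone`: the `k`-th power lives on the `k`-th cyclic diagonal. -/
theorem Oone_pow_apply {d m x k : ℕ} (hk : k ≤ d) (i j : Fin d) :
    (Oone d m x ^ k) i j =
      (if (j : ℕ) = i + k then omg d (k * gam m x) else 0) +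
        (if (j : ℕ) + d = i + k then omg d (((k : ℝ) - d) * gam m x) else 0) := by
  induction k generalizing i with
  | zero =>
    have hi := i.isLt
    have h : ¬ ((j : ℕ) + d = i) := by omega
    simp only [pow_zero, Matrix.one_apply, add_zero, h, if_false, Fin.ext_iff, Nat.cast_zero,
      zero_mul, eq_comm (a := (i : ℕ))]
    simp [omg]
  | succ k ih =>
    have hi := i.isLt
    have hj := j.isLt
    rw [pow_succ', Matrix.mul_apply]
    simp only [ih (by omega)]
    by_cases h : (i : ℕ) + 1 < d
    · rw [Finset.sum_eq_single ⟨i + 1, h⟩]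
      · have h1 : ¬ ((i : ℕ) = d - 1) := by omega
        simp only [Oone, Matrix.of_apply, h1, false_and, if_true, if_false, add_zero, mul_add,
          mul_ite, mul_zero, ← omg_add]
        congr 1
        · refine if_congr (by omega) (congrArg _ ?_) rfl
          push_cast
          ring
        · refine if_congr (by omega) (congrArg _ ?_) rfl
          push_cast
          ring
      · intro l _ hl
        have h1 : ¬ ((i : ℕ) = d - 1) := by omega
        have h2 : ¬ ((l : ℕ) = i + 1) := fun h => hl (Fin.ext h)
        simp [Oone, h1, h2]
      · simp
    · have h0 : (i : ℕ) = d - 1 := by omega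
      rw [Finset.sum_eq_single ⟨0, by omega⟩]
      · have h1 : ¬ (0 = (i : ℕ) + 1) := by omega
        have h2 : ¬ ((j : ℕ) + d = k) := by omega
        have h3 : ¬ ((j : ℕ) = i + (k + 1)) := by omega
        simp only [Oone, Matrix.of_apply, if_neg h1, if_neg h2, if_neg h3, add_zero, zero_add,
          and_true, if_pos h0, mul_ite, mul_zero, ← omg_add]
        refine if_congr (by omega) (congrArg _ ?_) rfl
        push_cast
        ring
      · intro l _ hl
        have h1 : ¬ ((l : ℕ) = i + 1) := by omega
        have h2 : ¬ ((l : ℕ) = 0) := fun h => hl (Fin.ext h)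
        simp [Oone, h1, h2]
      · simp

/-- The trigonometric identity behind the linear relation between the observables. -/
theorem exp_mul_sin_relation (x y : ℝ) :
    Complex.exp ((x + y : ℝ) * Complex.I) * (Real.sin y : ℂ) -
      Complex.exp (y * Complex.I) * (Real.sin (x + y) : ℂ) + (Real.sin x : ℂ) = 0 := by
  have h : Real.sin x = Real.sin (x + y) * Real.cos y - Real.cos (x + y) * Real.sin y := by
    rw [← Real.sin_sub, add_sub_cancel_right]
  rw [h, Complex.exp_mul_I, Complex.exp_mul_I]
  push_cast
  ring

theorem sqrt_coeff_relation {a b : ℝ} (ha : 0 < a) (hb : 0 < b) {u v : ℂ} {s : ℝ}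
    (h : u * s - v * b + a = 0) :
    u * ((s / √(a * b) : ℝ) : ℂ) - v * (√(b / a) : ℝ) + (√(a / b) : ℝ) = 0 := by
  have h1 : √(b / a) = b / √(a * b) := by
    rw [Real.sqrt_div' _ ha.le, Real.sqrt_mul ha.le]
    have := Real.sqrt_pos.2 ha
    have := Real.sqrt_pos.2 hb
    field_simp
    exact Real.sq_sqrt hb.le
  have h2 : √(a / b) = a / √(a * b) := by
    rw [Real.sqrt_div' _ hb.le, Real.sqrt_mul ha.le]
    have := Real.sqrt_pos.2 ha
    have := Real.sqrt_pos.2 hb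
    field_simp
    exact Real.sq_sqrt ha.le
  rw [h1, h2]
  push_cast
  linear_combination h / ((√(a * b) : ℝ) : ℂ)

theorem sin_pi_mul_div_pos {m a : ℕ} (ha : 0 < a) (ham : a < m) :
    0 < Real.sin (Real.pi * a / m) := by
  have hm : (0 : ℝ) < m := by exact_mod_cast ha.trans ham
  have ha' : (0 : ℝ) < a := by exact_mod_cast ha
  have ham' : (a : ℝ) < m := by exact_mod_cast ham
  apply Real.sin_pos_of_pos_of_lt_pi
  · positivity
  · rw [div_lt_iff₀ hm]
    exact mul_lt_mul_of_pos_left ham' Real.pi_pos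

theorem cos_pi_div_pos {m : ℕ} (hm : 3 ≤ m) : 0 < Real.cos (Real.pi / m) := by
  have hm' : (3 : ℝ) ≤ m := by exact_mod_cast hm
  have hpi := Real.pi_pos
  apply Real.cos_pos_of_mem_Ioo
  constructor
  · have : 0 < Real.pi / m := by positivity
    linarith
  · exact div_lt_div_of_pos_left hpi (by norm_num) (by linarith)

theorem sin_pi_mul_pred_div {m : ℕ} (hm : 3 ≤ m) :
    Real.sin (Real.pi * (((m - 2 : ℕ) : ℝ) + 1) / m) = Real.sin (Real.pi / m) := by
  have hm' : (m : ℝ) ≠ 0 := by positivity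
  rw [← Real.sin_pi_sub (Real.pi / m), Nat.cast_sub (by omega)]
  congr 1
  field_simp
  push_cast
  ring

theorem sin_pi_mul_sub_two_div {m : ℕ} (hm : 3 ≤ m) :
    Real.sin (Real.pi * ((m - 2 : ℕ) : ℝ) / m) =
      2 * Real.cos (Real.pi / m) * Real.sin (Real.pi / m) := by
  have hm' : (m : ℝ) ≠ 0 := by positivity
  rw [mul_right_comm, ← Real.sin_two_mul, ← Real.sin_pi_sub (2 * _), Nat.cast_sub (by omega)]
  congr 1
  field_simp
  push_cast
  ring

/-- The formula for `muc` at generic `α` also holds at `α = m - 2`. -/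
theorem muc_eq {d m : ℕ} (hd : d ≠ 0) (hm : 3 ≤ m) (α k : ℕ) :
    muc d m α k = omg d (((α : ℝ) + 1) * ((d : ℝ) - 2 * k) / (2 * m)) /
        ((2 * Real.cos (Real.pi / (2 * m)) : ℝ) : ℂ) *
      ((Real.sin (Real.pi / m) /
          √(Real.sin (Real.pi * α / m) * Real.sin (Real.pi * (α + 1) / m)) : ℝ) : ℂ) := by
  rw [muc]
  split_ifs with h
  · subst h
    have hm' : (m : ℝ) ≠ 0 := by positivity
    have hs : 0 < Real.sin (Real.pi / m) := by
      simpa using sin_pi_mul_div_pos (m := m) one_pos (by omega)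
    have hc := cos_pi_div_pos hm
    have hphase : omg d ((((m - 2 : ℕ) : ℝ) + 1) * ((d : ℝ) - 2 * k) / (2 * m)) =
        -(omg d (-(k : ℝ)) * omg d (-(((d : ℝ) - 2 * k) / (2 * m)))) := by
      have hhalf : omg d (d * (1 / 2)) = -1 := by
        rw [omg_mul_self hd, ← Complex.exp_pi_mul_I]
        congr 3
        ring
      rw [← neg_one_mul, ← hhalf, ← omg_add, ← omg_add, Nat.cast_sub (by omega)]
      congr 1
      field_simp
      push_cast
      ring
    have hsqrt : Real.sin (Real.pi / m) / √(2 * Real.cos (Real.pi / m) * Real.sin (Real.pi / m) *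
        Real.sin (Real.pi / m)) = 1 / √(2 * Real.cos (Real.pi / m)) := by
      rw [mul_assoc, Real.sqrt_mul (by positivity), Real.sqrt_mul_self hs.le]
      field_simp
    rw [hphase, sin_pi_mul_pred_div hm, sin_pi_mul_sub_two_div hm, hsqrt]
    push_cast
    rw [div_mul_div_comm, mul_one]
  · rfl

/-- The formula for `nuc` at generic `α` also holds at `α = m - 2`. -/
theorem nuc_eq {m : ℕ} (hm : 3 ≤ m) (d α k : ℕ) :
    nuc d m α k =
      -(omg d (((d : ℝ) - 2 * k) / (2 * m))) / ((2 * Real.cos (Real.pi / (2 * m)) : ℝ) : ℂ) *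
        ((√(Real.sin (Real.pi * (α + 1) / m) / Real.sin (Real.pi * α / m)) : ℝ) : ℂ) := by
  rw [nuc]
  split_ifs with h
  · subst h
    have hs : 0 < Real.sin (Real.pi / m) := by
      simpa using sin_pi_mul_div_pos (m := m) one_pos (by omega)
    rw [sin_pi_mul_pred_div hm, sin_pi_mul_sub_two_div hm, div_mul_cancel_right₀ hs.ne',
      Real.sqrt_inv]
    push_cast
    rw [← div_eq_mul_inv, div_div]
  · rfl

/-- The formula for `tauc` at generic `α` also holds at `α = m - 2`. -/
theorem tauc_eq {m : ℕ} (hm : 3 ≤ m) (α k : ℕ) :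
    tauc m α k =
      ((1 / (2 * Real.cos (Real.pi / (2 * m))) *
        √(Real.sin (Real.pi * α / m) / Real.sin (Real.pi * (α + 1) / m)) : ℝ) : ℂ) := by
  rw [tauc]
  split_ifs with h
  · subst h
    have hs : 0 < Real.sin (Real.pi / m) := by
      simpa using sin_pi_mul_div_pos (m := m) one_pos (by omega)
    rw [sin_pi_mul_pred_div hm, sin_pi_mul_sub_two_div hm, mul_div_cancel_right₀ _ hs.ne',
      one_div_mul_eq_div]
  · rfl

/-- The scalar form of the linear relation: it holds as soon as the exponents `p`, `q`, `r` differ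
from those of the coefficients by angles `ε π (α + 1) / m` and `ε π / m` with `ε = ±1`. -/
theorem coeff_relation {d m α : ℕ} (hd : d ≠ 0) (hm : 3 ≤ m) (hα : 1 ≤ α) (hαm : α ≤ m - 2)
    (k : ℕ) {ε p q r : ℝ} (hε : ε = 1 ∨ ε = -1)
    (hp : p = r + d * (ε * (α + 1) / (2 * m)) + ((α : ℝ) + 1) * ((d : ℝ) - 2 * k) / (2 * m))
    (hq : q = r + d * (ε / (2 * m)) + ((d : ℝ) - 2 * k) / (2 * m)) :
    (starRingEnd ℂ) (muc d m α k) * omg d p + (starRingEnd ℂ) (nuc d m α k) * omg d q +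
      tauc m α k * omg d r = 0 := by
  have hm' : (m : ℝ) ≠ 0 := by positivity
  have ha : 0 < Real.sin (Real.pi * α / m) := sin_pi_mul_div_pos hα (by omega)
  have hb : 0 < Real.sin (Real.pi * (α + 1) / m) := by
    exact_mod_cast sin_pi_mul_div_pos (m := m) (a := α + 1) (by omega) (by omega)
  have hu : omg d (d * (ε * (α + 1) / (2 * m))) * (Real.sin (Real.pi / m) : ℂ) -
      omg d (d * (ε / (2 * m))) * (Real.sin (Real.pi * (α + 1) / m) : ℂ) +
        (Real.sin (Real.pi * α / m) : ℂ) = 0 := by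
    rw [omg_mul_self hd, omg_mul_self hd]
    have key := exp_mul_sin_relation (ε * (Real.pi * α / m)) (ε * (Real.pi / m))
    have e1 : ε * (Real.pi * α / m) + ε * (Real.pi / m) = ε * (Real.pi * (α + 1) / m) := by ring
    have e2 : 2 * Real.pi * (ε * (α + 1) / (2 * m)) = ε * (Real.pi * (α + 1) / m) := by ring
    have e3 : 2 * Real.pi * (ε / (2 * m)) = ε * (Real.pi / m) := by ring
    rw [e1] at key
    rw [e2, e3]
    rcases hε with rfl | rfl
    · simpa only [one_mul] using key
    · simp only [neg_one_mul, Real.sin_neg, Complex.ofReal_neg] at key ⊢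
      linear_combination -key
  have hrel := sqrt_coeff_relation ha hb hu
  have hμ : omg d (-(((α : ℝ) + 1) * ((d : ℝ) - 2 * k) / (2 * m))) * omg d p =
      omg d r * omg d (d * (ε * (α + 1) / (2 * m))) := by
    rw [← omg_add, ← omg_add, hp]
    congr 1
    ring
  have hν : omg d (-(((d : ℝ) - 2 * k) / (2 * m))) * omg d q =
      omg d r * omg d (d * (ε / (2 * m))) := by
    rw [← omg_add, ← omg_add, hq]
    congr 1
    ring
  rw [muc_eq hd hm, nuc_eq hm, tauc_eq hm]
  simp only [map_mul, map_div₀, map_neg, Complex.conj_ofReal, star_omg]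
  rw [Complex.ofReal_mul (1 / _), Complex.ofReal_div 1, Complex.ofReal_one]
  generalize ((2 * Real.cos (Real.pi / (2 * m)) : ℝ) : ℂ) = C at *
  generalize ((√(Real.sin (Real.pi * (α + 1) / m) / Real.sin (Real.pi * α / m)) : ℝ) : ℂ) = B at *
  generalize ((Real.sin (Real.pi / m) /
    √(Real.sin (Real.pi * α / m) * Real.sin (Real.pi * (α + 1) / m)) : ℝ) : ℂ) = A at *
  linear_combination C⁻¹ * A * hμ - C⁻¹ * B * hν + C⁻¹ * omg d r * hrel

/-- The ideal observables satisfy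
conj(μ_{α,k}) O_{1,2}^k + conj(ν_{α,k}) O_{1,α+2}^k + τ_{α,k} O_{1,α+3}^k = 0
for all k = 1,…,d−1 and α = 1,…,m−2. -/
theorem stmt18 (d m : ℕ) (hd : 2 ≤ d) (hm : 3 ≤ m) :
    ∀ k α : ℕ, 1 ≤ k → k ≤ d - 1 → 1 ≤ α → α ≤ m - 2 →
      (starRingEnd ℂ) (muc d m α k) • (Oone d m 2) ^ k +
        (starRingEnd ℂ) (nuc d m α k) • (Oone d m (α + 2)) ^ k +
        tauc m α k • (Oone d m (α + 3)) ^ k = 0 := by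
  intro k α _ hkd hα hαm
  have hm' : (m : ℝ) ≠ 0 := by positivity
  have hd0 : d ≠ 0 := by omega
  ext i j
  simp only [Matrix.add_apply, Matrix.smul_apply, smul_eq_mul, Matrix.zero_apply,
    Oone_pow_apply (show k ≤ d by omega)]
  by_cases h1 : (j : ℕ) = i + k
  · have h2 : ¬ ((j : ℕ) + d = i + k) := by omega
    simp only [if_pos h1, if_neg h2, add_zero]
    refine coeff_relation hd0 hm hα hαm k (ε := -1) (Or.inr rfl) ?_ ?_ <;>
    · simp only [gam]
      field_simp
      push_cast
      ring
  · by_cases h2 : (j : ℕ) + d = i + k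
    · simp only [if_neg h1, if_pos h2, zero_add]
      refine coeff_relation hd0 hm hα hαm k (ε := 1) (Or.inl rfl) ?_ ?_ <;>
      · simp only [gam]
        field_simp
        push_cast
        ring
    · simp [h1, h2]
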